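/- Let β > 0, J_min > 0 and δ ∈ (0,1), set L = ln(2·(1−δ)/δ), and assume 4·β·J_min + 2·L > 0. Define C_δ = (J_min·β)/√(4·β·J_min + 2·L) and Δ₀ = 16·β·J_min + 8·L. Let l ≥ 1 be an integer and Δ = 2·l with Δ > Δ₀. If the chain consistency probability of the embedded star Hamiltonian satisfies P_cc(λ) ≥ δ, then λ ≥ C_δ·√Δ. -/

import Mathlib

open Finset Real

/-- Spin value of a boolean: `true ↦ +1`, `false ↦ -1`. -/
noncomputable def spin (b : Bool) : ℝ := if b then 1 else -1

/-- The embedded star Hamiltonian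
`H_e^λ = -λ·s₁·s₂ + (s₁+1)·(x₁+⋯+x_l) + (s₂-1)·(y₁+⋯+y_l)` on configurations
`σ = (s₁, s₂, x, y)`. -/
noncomputable def He (l : ℕ) (lam : ℝ)
    (σ : Bool × Bool × (Fin l → Bool) × (Fin l → Bool)) : ℝ :=
  -lam * spin σ.1 * spin σ.2.1 + (spin σ.1 + 1) * (∑ i, spin (σ.2.2.1 i)) +
    (spin σ.2.1 - 1) * (∑ i, spin (σ.2.2.2 i))

theorem sum_exp_mul_sum_spin (l : ℕ) (a : ℝ) :
    ∑ x : Fin l → Bool, exp (a * ∑ i, spin (x i)) = (2 * cosh a) ^ l := by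
  have h : 2 * cosh a = ∑ b : Bool, exp (a * spin b) := by
    simp [spin, Real.cosh_eq]
    ring
  rw [h, Fintype.sum_pow]
  simp only [mul_sum, exp_sum]

theorem sum_exp_neg_mul_He (l : ℕ) (lam b : ℝ) (s₁ s₂ : Bool) :
    ∑ x : Fin l → Bool, ∑ y : Fin l → Bool, exp (-b * He l lam (s₁, s₂, x, y)) =
      exp (b * lam * spin s₁ * spin s₂) * (2 * cosh (b * (spin s₁ + 1))) ^ l *
        (2 * cosh (b * (spin s₂ - 1))) ^ l := by
  rw [← cosh_neg (b * (spin s₁ + 1)), ← cosh_neg (b * (spin s₂ - 1)),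
    ← sum_exp_mul_sum_spin, ← sum_exp_mul_sum_spin, mul_assoc, sum_mul_sum, mul_sum]
  refine sum_congr rfl fun x _ => ?_
  rw [mul_sum]
  refine sum_congr rfl fun y _ => ?_
  rw [← exp_add, ← exp_add, He]
  ring_nf

theorem sum_exp_neg_mul_He_filter_eq (l : ℕ) (lam b : ℝ) :
    ∑ σ ∈ Finset.univ.filter
        (fun σ : Bool × Bool × (Fin l → Bool) × (Fin l → Bool) => σ.1 = σ.2.1),
      exp (-b * He l lam σ) = 4 ^ l * (2 * exp (b * lam) * cosh (2 * b) ^ l) := by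
  have h4 : (4 : ℝ) ^ l = 2 ^ l * 2 ^ l := by rw [← mul_pow]; norm_num
  rw [sum_filter]
  simp only [Fintype.sum_prod_type, Fintype.sum_bool, if_true, reduceCtorEq, if_false,
    sum_const_zero, add_zero, zero_add, sum_exp_neg_mul_He]
  have e₁ : b * (1 + 1) = 2 * b := by ring
  have e₂ : b * (-1 - 1) = -(2 * b) := by ring
  simp only [spin, if_true, Bool.false_eq_true, if_false, e₁, e₂, cosh_neg, sub_self,
    neg_add_cancel, mul_zero, cosh_zero, mul_pow, h4, mul_one, mul_neg, neg_neg]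
  ring

theorem sum_exp_neg_mul_He_univ (l : ℕ) (lam b : ℝ) :
    ∑ σ : Bool × Bool × (Fin l → Bool) × (Fin l → Bool), exp (-b * He l lam σ) =
      4 ^ l * (2 * exp (b * lam) * cosh (2 * b) ^ l +
        exp (-(b * lam)) * (1 + (cosh (2 * b) ^ l) ^ 2)) := by
  have h4 : (4 : ℝ) ^ l = 2 ^ l * 2 ^ l := by rw [← mul_pow]; norm_num
  simp only [Fintype.sum_prod_type, Fintype.sum_bool, sum_exp_neg_mul_He]
  have e₁ : b * (1 + 1) = 2 * b := by ring
  have e₂ : b * (-1 - 1) = -(2 * b) := by ring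
  simp only [spin, if_true, Bool.false_eq_true, if_false, e₁, e₂, cosh_neg, sub_self,
    neg_add_cancel, mul_zero, cosh_zero, mul_pow, h4, mul_one, mul_neg, neg_neg]
  ring

theorem cosh_pow_le_of_le_chain_consistency {l : ℕ} {lam b δ : ℝ} (hδ : 0 < δ)
    (h : δ ≤
      (∑ σ ∈ Finset.univ.filter
            (fun σ : Bool × Bool × (Fin l → Bool) × (Fin l → Bool) => σ.1 = σ.2.1),
          exp (-b * He l lam σ)) /
        (∑ σ : Bool × Bool × (Fin l → Bool) × (Fin l → Bool), exp (-b * He l lam σ))) :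
    cosh (2 * b) ^ l ≤ exp (2 * (b * lam)) * (2 * (1 - δ) / δ) := by
  rw [sum_exp_neg_mul_He_filter_eq, sum_exp_neg_mul_He_univ,
    mul_div_mul_left _ _ (by positivity)] at h
  have hc : 0 < cosh (2 * b) ^ l := pow_pos (cosh_pos _) l
  set c := cosh (2 * b) ^ l
  have hE : 0 < exp (b * lam) := exp_pos _
  rw [le_div_iff₀ (by positivity), exp_neg] at h
  rw [two_mul (b * lam), exp_add]
  set E := exp (b * lam)
  have h₁ : δ * (1 + c ^ 2) ≤ 2 * (1 - δ) * (E * E) * c := by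
    have h₂ := mul_le_mul_of_nonneg_left h hE.le
    have h₃ : E * (δ * (2 * E * c + E⁻¹ * (1 + c ^ 2))) =
        δ * (2 * E * E * c + (1 + c ^ 2)) := by
      field_simp
    rw [h₃] at h₂
    linarith
  rw [← mul_div_assoc, le_div_iff₀ hδ]
  refine le_of_mul_le_mul_right ?_ hc
  linarith

theorem one_add_sq_div_two_le_cosh (z : ℝ) : 1 + z ^ 2 / 2 ≤ cosh z := by
  rw [← cosh_abs, ← sq_abs]
  have h₁ : |z| / 2 ≤ sinh (|z| / 2) := self_le_sinh_iff.2 (by positivity)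
  have h₂ : cosh |z| = cosh (|z| / 2) ^ 2 + sinh (|z| / 2) ^ 2 := by
    rw [← cosh_two_mul]
    ring_nf
  have h₃ := pow_le_pow_left₀ (by positivity) h₁ 2
  linarith [cosh_sq (|z| / 2)]

theorem exp_lt_cosh_of_four_mul_lt_sq {u z : ℝ} (hu : 0 < u) (hu' : u ≤ 1 / 2)
    (h : 4 * u < z ^ 2) : exp u < cosh z := by
  have h₁ : exp u ≤ 1 + 2 * u := by
    have h₂ := one_sub_le_exp_neg u
    have h₃ : exp (-u) * exp u = 1 := by rw [← exp_add]; simp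
    have h₄ := exp_pos u
    nlinarith
  linarith [one_add_sq_div_two_le_cosh z]

/-- **`√Δ` lower bound on the chain strength.**
With `L = ln(2(1-δ)/δ)`, `C_δ = J_min·β/√(4βJ_min + 2L)` and `Δ₀ = 16βJ_min + 8L`,
for a logical spin of degree `Δ = 2l > Δ₀`, if the chain consistency
probability of the embedded star Hamiltonian at the effective inverse
temperature `β_eff = β·J_min/λ` is at least `δ`, then `λ ≥ C_δ·√Δ`. -/
theorem chain_strength_sqrt_degree_lower_bound
    (β Jmin δ : ℝ) (hβ : 0 < β) (hJ : 0 < Jmin) (hδ0 : 0 < δ) (hδ1 : δ < 1)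
    (L : ℝ) (hL : L = Real.log (2 * (1 - δ) / δ))
    (hpos : 0 < 4 * β * Jmin + 2 * L)
    (Cδ Δ0 : ℝ)
    (hC : Cδ = Jmin * β / Real.sqrt (4 * β * Jmin + 2 * L))
    (hΔ0 : Δ0 = 16 * β * Jmin + 8 * L)
    (l : ℕ) (hl : 1 ≤ l) (Δ : ℝ) (hΔ : Δ = 2 * l) (hΔgt : Δ0 < Δ)
    (lam : ℝ) (hlam : 0 < lam)
    (βeff : ℝ) (hβeff : βeff = β * Jmin / lam)
    (hPcc : δ ≤
      (∑ σ ∈ Finset.univ.filter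
            (fun σ : Bool × Bool × (Fin l → Bool) × (Fin l → Bool) => σ.1 = σ.2.1),
          Real.exp (-βeff * He l lam σ)) /
        (∑ σ : Bool × Bool × (Fin l → Bool) × (Fin l → Bool),
          Real.exp (-βeff * He l lam σ))) :
    Cδ * Real.sqrt Δ ≤ lam := by
  have hl0 : (0 : ℝ) < l := by exact_mod_cast hl
  have hΔpos : 0 < Δ := by linarith
  set K := 4 * β * Jmin + 2 * L with hK
  have hsΔ : √Δ ^ 2 = Δ := sq_sqrt hΔpos.le
  have hsK : √K ^ 2 = K := sq_sqrt hpos.le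
  have hKpos : 0 < √K := sqrt_pos.2 hpos
  by_contra! hlt
  have hsq : 4 * (K / Δ) < (2 * βeff) ^ 2 := by
    rw [hC, div_mul_eq_mul_div, lt_div_iff₀ hKpos] at hlt
    have h₁ : (lam * √K) ^ 2 < (Jmin * β * √Δ) ^ 2 :=
      pow_lt_pow_left₀ hlt (by positivity) two_ne_zero
    rw [mul_pow, mul_pow, hsΔ, hsK] at h₁
    rw [hβeff, ← mul_div_assoc, ← mul_div_assoc, div_pow, div_lt_div_iff₀ hΔpos (by positivity)]
    nlinarith
  have hu : K / Δ ≤ 1 / 2 := by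
    rw [div_le_div_iff₀ hΔpos two_pos]
    linarith
  have hcosh := exp_lt_cosh_of_four_mul_lt_sq (div_pos hpos hΔpos) hu hsq
  have hle := cosh_pow_le_of_le_chain_consistency hδ0 hPcc
  have hbl : βeff * lam = β * Jmin := by rw [hβeff]; field_simp
  have hr : 0 < 2 * (1 - δ) / δ := div_pos (by linarith) hδ0
  rw [hbl, ← exp_log hr, ← hL, ← exp_add] at hle
  have hpow : exp (K / Δ) ^ l < cosh (2 * βeff) ^ l :=
    pow_lt_pow_left₀ hcosh (exp_pos _).le (by lia)
  rw [← exp_nat_mul] at hpow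
  have hlK : l * (K / Δ) = 2 * (β * Jmin) + L := by
    rw [hΔ, hK]
    field_simp
    ring
  rw [hlK] at hpow
  exact hpow.not_ge hle
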